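/- Let k be a σ-field, A a nonzero k-σ-algebra, n ≥ 1, and d ≥ 1. Suppose χ is an invertible n × n matrix over A ⊗[k] A satisfying the cocycle condition ∂₂(χ) = ∂₁(χ) · ∂₃(χ) (the homomorphisms ∂ᵢ applied entrywise) and τ^d(χ) = (χᵀ)⁻¹ (τ^d applied entrywise). Then there exist an invertible n × n matrix α over A and an invertible n × n matrix a over k such that χ = δ₁(α) · δ₂(α)⁻¹ and σ_A^d(α) = (αᵀ)⁻¹ · (algebraMap k A applied entrywise to a). (This is the cocycle-level classification of torsors for the unitary σ-algebraic group G = {g ∈ GLₙ | σ^d(g) = (gᵀ)⁻¹}: every G-torsor is isomorphic to Y = {g ∈ GLₙ | σ^d(g) = (gᵀ)⁻¹ a} for some a ∈ GLₙ(k).) -/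

import Mathlib

open TensorProduct Matrix

/-- `δ₁ : A → A ⊗[k] A`, `a ↦ 1 ⊗ a`. -/
noncomputable def amitsurD1 (k A : Type*) [CommRing k] [CommRing A] [Algebra k A] :
    A →ₐ[k] A ⊗[k] A :=
  Algebra.TensorProduct.includeRight

/-- `δ₂ : A → A ⊗[k] A`, `a ↦ a ⊗ 1`. -/
noncomputable def amitsurD2 (k A : Type*) [CommRing k] [CommRing A] [Algebra k A] :
    A →ₐ[k] A ⊗[k] A :=
  Algebra.TensorProduct.includeLeft

/-- `∂₁ : A ⊗[k] A → A ⊗[k] A ⊗[k] A`, `a ⊗ b ↦ 1 ⊗ a ⊗ b`. -/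
noncomputable def amitsurP1 (k A : Type*) [CommRing k] [CommRing A] [Algebra k A] :
    A ⊗[k] A →ₐ[k] A ⊗[k] (A ⊗[k] A) :=
  Algebra.TensorProduct.includeRight

/-- `∂₂ : A ⊗[k] A → A ⊗[k] A ⊗[k] A`, `a ⊗ b ↦ a ⊗ 1 ⊗ b`. -/
noncomputable def amitsurP2 (k A : Type*) [CommRing k] [CommRing A] [Algebra k A] :
    A ⊗[k] A →ₐ[k] A ⊗[k] (A ⊗[k] A) :=
  Algebra.TensorProduct.map (AlgHom.id k A) Algebra.TensorProduct.includeRight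

/-- `∂₃ : A ⊗[k] A → A ⊗[k] A ⊗[k] A`, `a ⊗ b ↦ a ⊗ b ⊗ 1`. -/
noncomputable def amitsurP3 (k A : Type*) [CommRing k] [CommRing A] [Algebra k A] :
    A ⊗[k] A →ₐ[k] A ⊗[k] (A ⊗[k] A) :=
  Algebra.TensorProduct.map (AlgHom.id k A) Algebra.TensorProduct.includeLeft

section Descent

variable {k A : Type*} [Field k] [CommRing A] [Algebra k A]

/-- Contraction of the first tensor factor against a linear functional: `a ⊗ b ↦ φ a • b`. -/
noncomputable def contractFst {M : Type*} [AddCommGroup M] [Module k M] (φ : A →ₗ[k] k) :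
    A ⊗[k] M →ₗ[k] M :=
  TensorProduct.lid k M ∘ₗ TensorProduct.map φ LinearMap.id

@[simp]
lemma contractFst_tmul {M : Type*} [AddCommGroup M] [Module k M] (φ : A →ₗ[k] k) (a : A)
    (b : M) : contractFst φ (a ⊗ₜ[k] b) = φ a • b := by
  simp [contractFst]

lemma contractFst_amitsurP2 (φ : A →ₗ[k] k) (t : A ⊗[k] A) :
    contractFst φ (amitsurP2 k A t) = amitsurD1 k A (contractFst φ t) := by
  induction t with
  | zero => simp
  | add x y hx hy => simp only [map_add, hx, hy]
  | tmul a b => simp [amitsurP2, amitsurD1]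

lemma contractFst_amitsurP1_mul_amitsurP3 (φ : A →ₗ[k] k) (s t : A ⊗[k] A) :
    contractFst φ (amitsurP1 k A s * amitsurP3 k A t) =
      s * amitsurD2 k A (contractFst φ t) := by
  induction t with
  | zero => simp
  | add x y hx hy => simp only [map_add, mul_add, hx, hy]
  | tmul a b => simp [amitsurP1, amitsurP3, amitsurD2]

lemma contractFst_mul_tmul (φ : A →ₗ[k] k) (t : A ⊗[k] A) (a b : A) :
    contractFst φ (t * a ⊗ₜ[k] b) = b * contractFst (φ ∘ₗ LinearMap.mulRight k a) t := by
  induction t with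
  | zero => simp
  | add x y hx hy => simp only [map_add, add_mul, mul_add, hx, hy]
  | tmul c e => simp [mul_comm]

lemma contractFst_amitsurD2_mul_amitsurD1 (φ : A →ₗ[k] k) (a b : A) :
    contractFst φ (amitsurD2 k A a * amitsurD1 k A b) = φ a • b := by
  simp [amitsurD1, amitsurD2]

/-- The equalizer of `δ₁` and `δ₂` is the ground field. -/
lemma exists_algebraMap_eq_of_amitsurD1_eq_amitsurD2 [Nontrivial A] {x : A}
    (hx : amitsurD1 k A x = amitsurD2 k A x) : ∃ c : k, algebraMap k A c = x := by
  obtain ⟨φ, hφ⟩ := Module.Projective.exists_dual_eq_one k (one_ne_zero (α := A))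
  refine ⟨φ x, ?_⟩
  have h := congrArg (contractFst φ) hx
  simp only [amitsurD1, amitsurD2, Algebra.TensorProduct.includeRight_apply,
    Algebra.TensorProduct.includeLeft_apply, contractFst_tmul, hφ, one_smul] at h
  rw [Algebra.algebraMap_eq_smul_one, ← h]

variable {ι : Type*} [Fintype ι]

/-- The `k`-subspace of vectors `v` over `A` descended by `χ`: `χ · δ₂(v) = δ₁(v)`. -/
def descentSubmodule (χ : Matrix ι ι (A ⊗[k] A)) : Submodule k (ι → A) where
  carrier := {v | ∀ i, ∑ j, χ i j * amitsurD2 k A (v j) = amitsurD1 k A (v i)}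
  zero_mem' := by simp
  add_mem' {v w} hv hw i := by
    simp only [Pi.add_apply, map_add, mul_add, Finset.sum_add_distrib, hv i, hw i]
  smul_mem' c v hv i := by
    simp only [Pi.smul_apply, map_smul, mul_smul_comm, ← Finset.smul_sum, hv i]

lemma contractFst_col_mem_descentSubmodule {χ : Matrix ι ι (A ⊗[k] A)}
    (hcoc : χ.map (amitsurP2 k A) = χ.map (amitsurP1 k A) * χ.map (amitsurP3 k A))
    (φ : A →ₗ[k] k) (j : ι) :
    (fun i => contractFst φ (χ i j)) ∈ descentSubmodule χ := by
  intro i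
  have h := congrArg (contractFst φ) (congrFun (congrFun hcoc i) j)
  simp only [Matrix.map_apply, Matrix.mul_apply, map_sum, contractFst_amitsurP2,
    contractFst_amitsurP1_mul_amitsurP3] at h
  exact h.symm

lemma span_descentSubmodule [Nontrivial A] [DecidableEq ι]
    (χ : (Matrix ι ι (A ⊗[k] A))ˣ)
    (hcoc : χ.val.map (amitsurP2 k A) =
      χ.val.map (amitsurP1 k A) * χ.val.map (amitsurP3 k A)) :
    Submodule.span A (descentSubmodule χ.val : Set (ι → A)) = ⊤ := by
  obtain ⟨φ, hφ⟩ := Module.Projective.exists_dual_eq_one k (one_ne_zero (α := A))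
  have key (j : ι) (t : A ⊗[k] A) : (fun i => contractFst φ (χ.val i j * t)) ∈
      Submodule.span A (descentSubmodule χ.val : Set (ι → A)) := by
    induction t with
    | zero =>
      simp only [mul_zero, map_zero]
      exact Submodule.zero_mem (Submodule.span A (descentSubmodule χ.val : Set (ι → A)))
    | add x y hx hy => simpa only [mul_add, map_add] using! Submodule.add_mem _ hx hy
    | tmul a b =>
      simp only [contractFst_mul_tmul]
      exact Submodule.smul_mem _ b (Submodule.subset_span
        (contractFst_col_mem_descentSubmodule hcoc _ j))
  rw [eq_top_iff, ← (Pi.basisFun A ι).span_eq, Submodule.span_le]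
  rintro _ ⟨m, rfl⟩
  suffices h : Pi.basisFun A ι m =
      ∑ j, fun i => contractFst φ (χ.val i j * (χ⁻¹).val j m) by
    rw [h]
    exact Submodule.sum_mem _ fun j _ => key j _
  ext i
  have h := congrArg (contractFst φ) (congrFun (congrFun χ.mul_inv i) m)
  simp only [Matrix.mul_apply, map_sum] at h
  rw [Finset.sum_apply, h, Pi.basisFun_apply, Matrix.one_apply, Pi.single_apply]
  split_ifs <;> simp [Algebra.TensorProduct.one_def, hφ]

lemma linearIndependent_of_mem_descentSubmodule {χ : Matrix ι ι (A ⊗[k] A)} {κ : Type*}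
    {v : κ → ι → A} (hv : ∀ l, v l ∈ descentSubmodule χ) (hli : LinearIndependent k v) :
    LinearIndependent A v := by
  rw [linearIndependent_iff'] at hli ⊢
  intro s c hc l hl
  refine (Module.forall_dual_apply_eq_zero_iff k (c l)).1 fun φ => ?_
  refine hli s (fun l => φ (c l)) ?_ l hl
  ext i
  have h0 : ∑ l ∈ s, amitsurD2 k A (c l) * amitsurD1 k A (v l i) = 0 := by
    calc ∑ l ∈ s, amitsurD2 k A (c l) * amitsurD1 k A (v l i)
        = ∑ j, χ i j * amitsurD2 k A ((∑ l ∈ s, c l • v l) j) := by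
          simp only [← hv _ i, Finset.mul_sum, Finset.sum_apply, map_sum, Pi.smul_apply,
            smul_eq_mul, map_mul]
          rw [Finset.sum_comm]
          exact Finset.sum_congr rfl fun _ _ => Finset.sum_congr rfl fun _ _ => by ring
      _ = 0 := by simp only [hc, Pi.zero_apply, map_zero, mul_zero, Finset.sum_const_zero]
  have h := congrArg (contractFst φ) h0
  simpa [map_sum, contractFst_amitsurD2_mul_amitsurD1] using h

/-- Hilbert 90 for the Amitsur complex: every `GLₙ`-valued cocycle is a coboundary. -/
theorem exists_mul_map_amitsurD2_eq_map_amitsurD1 [Nontrivial A] [DecidableEq ι]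
    (χ : (Matrix ι ι (A ⊗[k] A))ˣ)
    (hcoc : χ.val.map (amitsurP2 k A) =
      χ.val.map (amitsurP1 k A) * χ.val.map (amitsurP3 k A)) :
    ∃ α : (Matrix ι ι A)ˣ,
      χ.val * α.val.map (amitsurD2 k A) = α.val.map (amitsurD1 k A) := by
  let b := Module.Basis.ofVectorSpace k (descentSubmodule χ.val)
  have hli : LinearIndependent A (fun l => (b l : ι → A)) :=
    linearIndependent_of_mem_descentSubmodule (fun l => (b l).2)
      (b.linearIndependent.map' (descentSubmodule χ.val).subtype (Submodule.ker_subtype _))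
  have hsp : ⊤ ≤ Submodule.span A (Set.range fun l => (b l : ι → A)) := by
    rw [← span_descentSubmodule χ hcoc, Submodule.span_le]
    intro v hv
    have h : v ∈ Submodule.span k (Set.range fun l => (b l : ι → A)) := by
      have h1 := Submodule.mem_map_of_mem (f := (descentSubmodule χ.val).subtype)
        (b.mem_span ⟨v, hv⟩)
      rwa [Submodule.map_span, ← Set.range_comp] at h1
    exact Submodule.span_le_restrictScalars k A _ h
  let B := Module.Basis.mk hli hsp
  let e := B.indexEquiv (Pi.basisFun A ι)
  let B' := B.reindex e
  have hB (l : ι) : B' l ∈ descentSubmodule χ.val := by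
    simp only [B', B, Module.Basis.reindex_apply, Module.Basis.mk_apply]
    exact (b _).2
  refine ⟨⟨(Pi.basisFun A ι).toMatrix B', B'.toMatrix (Pi.basisFun A ι),
    Module.Basis.toMatrix_mul_toMatrix_flip _ _, Module.Basis.toMatrix_mul_toMatrix_flip _ _⟩, ?_⟩
  ext i l
  simpa [Matrix.mul_apply, Module.Basis.toMatrix_apply] using hB l i

end Descent

/-- Cocycle-level classification of torsors for the unitary σ-algebraic group
`G = {g ∈ GLₙ | σᵈ(g) = (gᵀ)⁻¹}`: every cocycle `χ` with `τᵈ(χ) = (χᵀ)⁻¹` is of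
the form `δ₁(α)·δ₂(α)⁻¹` with `σᵈ(α) = (αᵀ)⁻¹ a` for some `a ∈ GLₙ(k)`. -/
theorem torsors_unitary_group (k A : Type*) [Field k] [CommRing A] [Algebra k A]
    [Nontrivial A]
    (σk : k →+* k) (σA : A →+* A)
    (hσ : ∀ c : k, σA (algebraMap k A c) = algebraMap k A (σk c))
    (τ : A ⊗[k] A →+* A ⊗[k] A)
    (hτ : ∀ a b : A, τ (a ⊗ₜ[k] b) = σA a ⊗ₜ[k] σA b)
    (n d : ℕ) (hn : 1 ≤ n) (hd : 1 ≤ d)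
    (χ : (Matrix (Fin n) (Fin n) (A ⊗[k] A))ˣ)
    (hcoc : χ.val.map (amitsurP2 k A) =
      χ.val.map (amitsurP1 k A) * χ.val.map (amitsurP3 k A))
    (hτχ : χ.val.map (τ ^ d) = ((χ⁻¹).val)ᵀ) :
    ∃ (α : (Matrix (Fin n) (Fin n) A)ˣ) (a : (Matrix (Fin n) (Fin n) k)ˣ),
      χ = Units.map ((amitsurD1 k A).toRingHom.mapMatrix.toMonoidHom) α *
          (Units.map ((amitsurD2 k A).toRingHom.mapMatrix.toMonoidHom) α)⁻¹ ∧
      α.val.map (σA ^ d) = ((α⁻¹).val)ᵀ * (a.val.map (algebraMap k A)) := by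
  obtain ⟨α, hα⟩ := exists_mul_map_amitsurD2_eq_map_amitsurD1 χ hcoc
  have hτ1 (x : A) : (τ ^ d) (amitsurD1 k A x) = amitsurD1 k A ((σA ^ d) x) := by
    clear hd hτχ
    induction d generalizing x with
    | zero => simp
    | succ d ih =>
      simp only [pow_succ, RingHom.mul_def, RingHom.comp_apply]
      rw [← ih]
      simp [amitsurD1, hτ]
  have hτ2 (x : A) : (τ ^ d) (amitsurD2 k A x) = amitsurD2 k A ((σA ^ d) x) := by
    clear hd hτχ hτ1
    induction d generalizing x with
    | zero => simp
    | succ d ih =>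
      simp only [pow_succ, RingHom.mul_def, RingHom.comp_apply]
      rw [← ih]
      simp [amitsurD2, hτ]
  set M : Matrix (Fin n) (Fin n) A := α.valᵀ * α.val.map (σA ^ d) with hM
  have hMunit : IsUnit M :=
    ((Matrix.isUnit_transpose _).2 α.isUnit).mul (α.isUnit.map (σA ^ d).mapMatrix)
  have hτα : ((χ⁻¹).val)ᵀ * (α.val.map (σA ^ d)).map (amitsurD2 k A) =
      (α.val.map (σA ^ d)).map (amitsurD1 k A) := by
    have h := congrArg (fun N => N.map (τ ^ d)) hα
    simp only [Matrix.map_mul, hτχ, Matrix.map_map] at h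
    have h1 : ⇑(τ ^ d) ∘ ⇑(amitsurD1 k A) = ⇑(amitsurD1 k A) ∘ ⇑(σA ^ d) := funext hτ1
    have h2 : ⇑(τ ^ d) ∘ ⇑(amitsurD2 k A) = ⇑(amitsurD2 k A) ∘ ⇑(σA ^ d) := funext hτ2
    simpa only [Matrix.map_map, h1, h2] using h
  have hαT : (α.val.map (amitsurD1 k A))ᵀ * ((χ⁻¹).val)ᵀ = (α.val.map (amitsurD2 k A))ᵀ := by
    rw [← Matrix.transpose_mul, ← hα, Units.inv_mul_cancel_left]
  have hMD : M.map (amitsurD1 k A) = M.map (amitsurD2 k A) := by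
    rw [hM, Matrix.map_mul, Matrix.map_mul, ← hτα, ← Matrix.mul_assoc, Matrix.transpose_map, hαT,
      Matrix.transpose_map]
  choose a ha using fun i j => exists_algebraMap_eq_of_amitsurD1_eq_amitsurD2
    (congrFun (congrFun hMD i) j)
  have haM : (Matrix.of a).map (algebraMap k A) = M := by
    ext i j; exact ha i j
  have haunit : IsUnit (Matrix.of a) := by
    rw [Matrix.isUnit_iff_isUnit_det, isUnit_iff_ne_zero]
    intro h0
    have h1 := (Matrix.isUnit_iff_isUnit_det _).1 hMunit
    rw [← haM, ← RingHom.mapMatrix_apply, ← RingHom.map_det, h0, map_zero] at h1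
    exact not_isUnit_zero h1
  refine ⟨α, haunit.unit, ?_, ?_⟩
  · rw [eq_mul_inv_iff_mul_eq]
    exact Units.ext hα
  · rw [IsUnit.unit_spec, haM, hM, ← Matrix.mul_assoc, ← Matrix.transpose_mul, Units.mul_inv,
      Matrix.transpose_one, Matrix.one_mul]
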